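/- (Generalized Type Safety) If a standard term t is closed, t →ca* T for some type T (where →ca = →c ∪ →a), and t →c* t' where t' is a normal form with respect to →c, then t' is a standard value. -/

import Mathlib

/-- Simple types: `T ::= A | T₁ ⇒ T₂`. -/
inductive MTy : Type
  | base : MTy
  | arrow : MTy → MTy → MTy
  deriving DecidableEq

/-- Mixed terms (de Bruijn indices for variables):
`m ::= x | λx:T.m | m m' | a | f | A | T ⇒ m`. -/
inductive MTm : Type
  | var : ℕ → MTm
  | lam : MTy → MTm → MTm
  | app : MTm → MTm → MTm
  | ca : MTm            -- the term constant `a`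
  | cf : MTm            -- the term constant `f`
  | tyA : MTm           -- the base type `A` as a mixed term
  | arr : MTy → MTm → MTm  -- `T ⇒ m`
  deriving DecidableEq

namespace MTm

/-- The embedding of types into mixed terms. -/
def ofTy : MTy → MTm
  | .base => tyA
  | .arrow T1 T2 => arr T1 (ofTy T2)

/-- de Bruijn shifting of indices `≥ c` by `d`. -/
def shift (d c : ℕ) : MTm → MTm
  | var k => if k < c then var k else var (k + d)
  | lam T m => lam T (shift d (c + 1) m)
  | app m1 m2 => app (shift d c m1) (shift d c m2)
  | ca => ca
  | cf => cf
  | tyA => tyA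
  | arr T m => arr T (shift d c m)

/-- Capture-avoiding substitution `[s / j] m` (de Bruijn). -/
def subst (j : ℕ) (s : MTm) : MTm → MTm
  | var k => if k = j then s else if j < k then var (k - 1) else var k
  | lam T m => lam T (subst (j + 1) (shift 1 0 s) m)
  | app m1 m2 => app (subst j s m1) (subst j s m2)
  | ca => ca
  | cf => cf
  | tyA => tyA
  | arr T m => arr T (subst j s m)

/-- Mixed values: `u ::= λx:T.m | T ⇒ m | A | a | f`. -/
inductive IsValue : MTm → Prop
  | lam (T m) : IsValue (lam T m)
  | arr (T m) : IsValue (arr T m)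
  | tyA : IsValue tyA
  | ca : IsValue ca
  | cf : IsValue cf

/-- Abstract reduction `→a`, closed under arbitrary contexts. -/
inductive StepA : MTm → MTm → Prop
  | beta (T m) : StepA (app (arr T m) (ofTy T)) m
  | lamAbs (T m) : StepA (lam T m) (arr T (subst 0 (ofTy T) m))
  | cfAbs : StepA cf (arr .base tyA)
  | caAbs : StepA ca tyA
  | lamC {m m'} (T) : StepA m m' → StepA (lam T m) (lam T m')
  | appL {m1 m1'} (m2) : StepA m1 m1' → StepA (app m1 m2) (app m1' m2)
  | appR {m2 m2'} (m1) : StepA m2 m2' → StepA (app m1 m2) (app m1 m2')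
  | arrC {m m'} (T) : StepA m m' → StepA (arr T m) (arr T m')

/-- Concrete full β-reduction `→b`, closed under arbitrary contexts. -/
inductive StepB : MTm → MTm → Prop
  | beta (T m m') : StepB (app (lam T m) m') (subst 0 m' m)
  | fa : StepB (app cf ca) ca
  | lamC {m m'} (T) : StepB m m' → StepB (lam T m) (lam T m')
  | appL {m1 m1'} (m2) : StepB m1 m1' → StepB (app m1 m2) (app m1' m2)
  | appR {m2 m2'} (m1) : StepB m2 m2' → StepB (app m1 m2) (app m1 m2')
  | arrC {m m'} (T) : StepB m m' → StepB (arr T m) (arr T m')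

/-- Call-by-value reduction `→c`: redexes contracted inside
call-by-value evaluation contexts `E_c ::= * | E_c m | u E_c`. -/
inductive StepC : MTm → MTm → Prop
  | beta {u} (T m) : IsValue u → StepC (app (lam T m) u) (subst 0 u m)
  | fa : StepC (app cf ca) ca
  | appL {m1 m1'} (m2) : StepC m1 m1' → StepC (app m1 m2) (app m1' m2)
  | appR {u m2 m2'} : IsValue u → StepC m2 m2' → StepC (app u m2) (app u m2')

/-- Standard terms: mixed terms containing no type subterm. -/
inductive IsStandard : MTm → Prop
  | var (x) : IsStandard (var x)
  | lam (T) {t} : IsStandard t → IsStandard (lam T t)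
  | app {t1 t2} : IsStandard t1 → IsStandard t2 → IsStandard (app t1 t2)
  | ca : IsStandard ca
  | cf : IsStandard cf

/-- Standard values: `v ::= λx:T.t | a | f` with `t` standard. -/
inductive IsStdValue : MTm → Prop
  | lam (T) {t} : IsStandard t → IsStdValue (lam T t)
  | ca : IsStdValue ca
  | cf : IsStdValue cf

/-- All free de Bruijn indices are `< n`. -/
def ClosedUnder : ℕ → MTm → Prop
  | n, var k => k < n
  | n, lam _ m => ClosedUnder (n + 1) m
  | n, app m1 m2 => ClosedUnder n m1 ∧ ClosedUnder n m2
  | _, ca => True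
  | _, cf => True
  | _, tyA => True
  | n, arr _ m => ClosedUnder n m

/-- Quasi-stuck terms. -/
inductive QuasiStuck : MTm → Prop
  | val {u} : IsValue u → QuasiStuck u
  | app_ca {s} : QuasiStuck s → QuasiStuck (app ca s)
  | app_tyA {s} : QuasiStuck s → QuasiStuck (app tyA s)
  | app_cf {s} : QuasiStuck s → s ≠ ca → s ≠ tyA → QuasiStuck (app cf s)
  | app_AA {s} : QuasiStuck s → s ≠ ca → s ≠ tyA →
      QuasiStuck (app (arr .base tyA) s)
  | app_lam {s} (T m) : QuasiStuck s → ¬ IsValue s → QuasiStuck (app (lam T m) s)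
  | app_arr {s} (T m) : QuasiStuck s → ¬ IsValue s → QuasiStuck (app (arr T m) s)
  | app_app {s s'} : QuasiStuck s → QuasiStuck s' → ¬ IsValue s →
      QuasiStuck (app s s')

end MTm

namespace MTm

open Relation

theorem ClosedUnder.mono {m : MTm} {n k : ℕ} (h : ClosedUnder n m) (hk : n ≤ k) :
    ClosedUnder k m := by
  induction m generalizing n k with
  | var i => exact lt_of_lt_of_le h hk
  | lam T m ih => exact ih (n := n + 1) h (by omega)
  | app m1 m2 ih1 ih2 => exact ⟨ih1 h.1 hk, ih2 h.2 hk⟩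
  | arr T m ih => exact ih (n := n) h hk
  | _ => trivial

theorem closedUnder_ofTy (n : ℕ) (T : MTy) : ClosedUnder n (ofTy T) := by
  induction T with
  | base => trivial
  | arrow T1 T2 _ ih => exact ih

theorem isValue_ofTy (T : MTy) : IsValue (ofTy T) := by
  cases T with
  | base => exact .tyA
  | arrow T1 T2 => exact .arr _ _

theorem shift_of_closedUnder {m : MTm} {n c : ℕ} (d : ℕ) (h : ClosedUnder n m) (hc : n ≤ c) :
    shift d c m = m := by
  induction m generalizing n c with
  | var i => exact if_pos (lt_of_lt_of_le h hc)
  | lam T m ih => exact congrArg (lam T) (ih (n := n + 1) h (by omega))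
  | app m1 m2 ih1 ih2 => exact congrArg₂ app (ih1 h.1 hc) (ih2 h.2 hc)
  | arr T m ih => exact congrArg (arr T) (ih (n := n) h hc)
  | _ => rfl

theorem subst_of_closedUnder {m : MTm} {n j : ℕ} (s : MTm) (h : ClosedUnder n m) (hj : n ≤ j) :
    subst j s m = m := by
  induction m generalizing n j s with
  | var i =>
    have hi : i < n := h
    simp only [subst]
    rw [if_neg (by omega), if_neg (by omega)]
  | lam T m ih => exact congrArg (lam T) (ih (n := n + 1) _ h (by omega))
  | app m1 m2 ih1 ih2 => exact congrArg₂ app (ih1 s h.1 hj) (ih2 s h.2 hj)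
  | arr T m ih => exact congrArg (arr T) (ih (n := n) s h hj)
  | _ => rfl

theorem subst_lam_of_closed {s : MTm} (hs : ClosedUnder 0 s) (j : ℕ) (T : MTy) (m : MTm) :
    subst j s (lam T m) = lam T (subst (j + 1) s m) := by
  simp only [subst, shift_of_closedUnder 1 hs le_rfl]

theorem ClosedUnder.subst {s m : MTm} {n j : ℕ} (hs : ClosedUnder 0 s)
    (h : ClosedUnder (n + 1) m) (hj : j ≤ n) : ClosedUnder n (subst j s m) := by
  induction m generalizing n j with
  | var i =>
    have hi : i < n + 1 := h
    simp only [MTm.subst]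
    split_ifs
    · exact hs.mono (Nat.zero_le n)
    · change i - 1 < n
      omega
    · change i < n
      omega
  | lam T m ih =>
    rw [subst_lam_of_closed hs]
    exact ih (n := n + 1) h (by omega)
  | app m1 m2 ih1 ih2 => exact ⟨ih1 h.1 hj, ih2 h.2 hj⟩
  | arr T m ih => exact ih (n := n) h hj
  | _ => trivial

theorem subst_subst_comm {s t : MTm} (hs : ClosedUnder 0 s) (ht : ClosedUnder 0 t) (m : MTm)
    {i j : ℕ} (hij : i ≤ j) : subst j s (subst i t m) = subst i t (subst (j + 1) s m) := by
  induction m generalizing i j with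
  | var k =>
    rcases lt_trichotomy k i with hk | rfl | hk
    · simp only [subst, show ¬ k = i by omega, show ¬ i < k by omega, show ¬ k = j by omega,
        show ¬ j < k by omega, show ¬ k = j + 1 by omega, show ¬ j + 1 < k by omega, if_false]
    · simp only [subst, show ¬ k = j + 1 by omega, show ¬ j + 1 < k by omega, if_false, if_true]
      exact subst_of_closedUnder s ht (Nat.zero_le j)
    · rcases lt_trichotomy k (j + 1) with hk' | rfl | hk'
      · simp only [subst, show ¬ k = i by omega, hk, show ¬ k - 1 = j by omega,
          show ¬ j < k - 1 by omega, show ¬ k = j + 1 by omega, show ¬ j + 1 < k by omega,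
          if_false, if_true]
      · simp only [subst, show ¬ j + 1 = i by omega, hk, if_false, if_true, Nat.add_sub_cancel]
        exact (subst_of_closedUnder t hs (Nat.zero_le i)).symm
      · simp only [subst, show ¬ k = i by omega, hk, show ¬ k - 1 = j by omega,
          show j < k - 1 by omega, show ¬ k = j + 1 by omega, hk', show ¬ k - 1 = i by omega,
          show i < k - 1 by omega, if_false, if_true]
  | lam T m ih =>
    simp only [subst_lam_of_closed hs, subst_lam_of_closed ht]
    exact congrArg (lam T) (ih (by omega))
  | app m1 m2 ih1 ih2 => exact congrArg₂ app (ih1 hij) (ih2 hij)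
  | arr T m ih => exact congrArg (arr T) (ih hij)
  | _ => rfl

theorem StepA.closedUnder {m m' : MTm} (h : StepA m m') {n : ℕ} (hm : ClosedUnder n m) :
    ClosedUnder n m' := by
  induction h generalizing n with
  | beta T m => exact hm.1
  | lamAbs T m => exact ClosedUnder.subst (closedUnder_ofTy 0 T) hm (Nat.zero_le n)
  | cfAbs => trivial
  | caAbs => trivial
  | lamC T _ ih => exact ih (n := n + 1) hm
  | appL m2 _ ih => exact ⟨ih hm.1, hm.2⟩
  | appR m1 _ ih => exact ⟨hm.1, ih hm.2⟩
  | arrC T _ ih => exact ih (n := n) hm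

theorem StepC.closedUnder {m m' : MTm} (h : StepC m m') (hm : ClosedUnder 0 m) :
    ClosedUnder 0 m' := by
  induction h with
  | beta T m _ => exact ClosedUnder.subst hm.2 hm.1 le_rfl
  | fa => trivial
  | appL m2 _ ih => exact ⟨ih hm.1, hm.2⟩
  | appR _ _ ih => exact ⟨hm.1, ih hm.2⟩

theorem IsStandard.subst {s m : MTm} (hc : ClosedUnder 0 s) (hs : IsStandard s)
    (hm : IsStandard m) (j : ℕ) : IsStandard (subst j s m) := by
  induction hm generalizing j with
  | var k =>
    simp only [MTm.subst]
    split_ifs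
    · exact hs
    · exact .var _
    · exact .var _
  | lam T _ ih =>
    rw [subst_lam_of_closed hc]
    exact .lam T (ih _)
  | app _ _ ih1 ih2 => exact .app (ih1 j) (ih2 j)
  | ca => exact .ca
  | cf => exact .cf

theorem StepC.isStandard {m m' : MTm} (h : StepC m m') (hc : ClosedUnder 0 m)
    (hm : IsStandard m) : IsStandard m' := by
  induction h with
  | beta T m _ =>
    cases hm with
    | app h1 h2 =>
      cases h1 with
      | lam _ h1 => exact IsStandard.subst hc.2 h2 h1 0
  | fa => exact .ca
  | appL m2 _ ih =>
    cases hm with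
    | app h1 h2 => exact .app (ih hc.1 h1) h2
  | appR _ _ ih =>
    cases hm with
    | app h1 h2 => exact .app h1 (ih hc.2 h2)

theorem StepA.subst {s m m' : MTm} (hs : ClosedUnder 0 s) (h : StepA m m') (j : ℕ) :
    StepA (subst j s m) (subst j s m') := by
  induction h generalizing j with
  | beta T m =>
    simp only [MTm.subst, subst_of_closedUnder s (closedUnder_ofTy 0 T) (Nat.zero_le j)]
    exact .beta T _
  | lamAbs T m =>
    rw [subst_lam_of_closed hs]
    simp only [MTm.subst, subst_subst_comm hs (closedUnder_ofTy 0 T) m (Nat.zero_le j)]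
    exact .lamAbs T _
  | cfAbs => exact .cfAbs
  | caAbs => exact .caAbs
  | lamC T _ ih =>
    simp only [subst_lam_of_closed hs]
    exact .lamC T (ih _)
  | appL m2 _ ih => exact .appL _ (ih j)
  | appR m1 _ ih => exact .appR _ (ih j)
  | arrC T _ ih => exact .arrC T (ih j)

theorem reflTransGen_stepA_subst_left {s m m' : MTm} (hs : ClosedUnder 0 s)
    (h : ReflTransGen StepA m m') (j : ℕ) :
    ReflTransGen StepA (subst j s m) (subst j s m') :=
  h.lift (subst j s) fun _ _ h => h.subst hs j

theorem reflTransGen_stepA_closedUnder {m m' : MTm} (h : ReflTransGen StepA m m')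
    (hm : ClosedUnder 0 m) : ClosedUnder 0 m' := by
  induction h with
  | refl => exact hm
  | tail _ h ih => exact h.closedUnder ih

theorem reflTransGen_stepA_subst_right {s s' : MTm} (hs : ClosedUnder 0 s)
    (h : ReflTransGen StepA s s') (m : MTm) (j : ℕ) :
    ReflTransGen StepA (subst j s m) (subst j s' m) := by
  have hs' := reflTransGen_stepA_closedUnder h hs
  induction m generalizing j with
  | var k =>
    simp only [subst]
    split_ifs
    · exact h
    · exact .refl
    · exact .refl
  | lam T m ih =>
    simp only [subst_lam_of_closed hs, subst_lam_of_closed hs']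
    exact (ih (j + 1)).lift (lam T) fun _ _ => .lamC T
  | app m1 m2 ih1 ih2 =>
    exact ((ih1 j).lift (app · (subst j s m2)) fun _ _ => .appL _).trans
      ((ih2 j).lift (app (subst j s' m1)) fun _ _ => .appR _)
  | arr T m ih => exact (ih j).lift (arr T) fun _ _ => .arrC T
  | _ => exact .refl

/-- The combined reduction `→ca`. -/
abbrev StepCA (x y : MTm) : Prop := StepC x y ∨ StepA x y

theorem reflTransGen_stepCA_of_stepA {x y : MTm} (h : ReflTransGen StepA x y) :
    ReflTransGen StepCA x y :=
  ReflTransGen.mono (fun _ _ => Or.inr) _ _ h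

theorem IsValue.not_stepC {u m : MTm} (hu : IsValue u) : ¬ StepC u m := by
  intro h
  cases hu <;> cases h

theorem IsValue.stepA {u m : MTm} (hu : IsValue u) (h : StepA u m) : IsValue m := by
  cases hu <;> cases h <;> constructor

theorem IsValue.reflTransGen_stepA {u m : MTm} (hu : IsValue u)
    (h : ReflTransGen StepCA u m) : ReflTransGen StepA u m := by
  induction h using ReflTransGen.head_induction_on with
  | refl => exact .refl
  | head h _ ih =>
    rcases h with h | h
    · exact absurd h hu.not_stepC
    · exact .head h (ih (hu.stepA h))

/-- `Contract u x r`: the application `u x` of mixed values is a root redex of `→ca`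
with contractum `r`. -/
inductive Contract : MTm → MTm → MTm → Prop
  | lam {u} (T m) : IsValue u → Contract (lam T m) u (subst 0 u m)
  | fa : Contract cf ca ca
  | arr (T m) : Contract (arr T m) (ofTy T) m

theorem Contract.isValue_left {u x r : MTm} (h : Contract u x r) : IsValue u := by
  cases h <;> constructor

theorem Contract.isValue_right {u x r : MTm} (h : Contract u x r) : IsValue x := by
  cases h with
  | lam T m hu => exact hu
  | fa => exact .ca
  | arr T m => exact isValue_ofTy T

theorem Contract.stepCA {u x r : MTm} (h : Contract u x r) : StepCA (app u x) r := by
  cases h with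
  | lam T m hu => exact .inl (.beta T m hu)
  | fa => exact .inl .fa
  | arr T m => exact .inr (.beta T r)

/-- An application reducing to a value reduces, after evaluating both of its sides,
by a root contraction. -/
theorem exists_contract {m1 m2 v : MTm} (hv : IsValue v)
    (h : ReflTransGen StepCA (app m1 m2) v) :
    ∃ u x r, ReflTransGen StepCA m1 u ∧ ReflTransGen StepCA m2 x ∧ Contract u x r ∧
      ReflTransGen StepCA r v := by
  generalize hm : app m1 m2 = m at h
  induction h using ReflTransGen.head_induction_on generalizing m1 m2 with
  | refl => subst hm; cases hv
  | head h h' ih =>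
    subst hm
    rcases h with h | h
    · cases h with
      | beta T m hu => exact ⟨_, _, _, .refl, .refl, .lam T m hu, h'⟩
      | fa => exact ⟨_, _, _, .refl, .refl, .fa, h'⟩
      | appL _ h =>
        obtain ⟨u, x, r, h1, h2, h3, h4⟩ := ih rfl
        exact ⟨u, x, r, .head (.inl h) h1, h2, h3, h4⟩
      | appR _ h =>
        obtain ⟨u, x, r, h1, h2, h3, h4⟩ := ih rfl
        exact ⟨u, x, r, h1, .head (.inl h) h2, h3, h4⟩
    · cases h with
      | beta T m => exact ⟨_, _, _, .refl, .refl, .arr T _, h'⟩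
      | appL _ h =>
        obtain ⟨u, x, r, h1, h2, h3, h4⟩ := ih rfl
        exact ⟨u, x, r, .head (.inr h) h1, h2, h3, h4⟩
      | appR _ h =>
        obtain ⟨u, x, r, h1, h2, h3, h4⟩ := ih rfl
        exact ⟨u, x, r, h1, .head (.inr h) h2, h3, h4⟩

theorem reflTransGen_app_of_contract {m1 m2 u x r v : MTm} (h1 : ReflTransGen StepCA m1 u)
    (h2 : ReflTransGen StepCA m2 x) (h : Contract u x r) (hr : ReflTransGen StepCA r v) :
    ReflTransGen StepCA (app m1 m2) v := by
  have l1 : ReflTransGen StepCA (app m1 m2) (app u m2) :=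
    h1.lift (app · m2) fun _ _ h => h.imp (.appL m2) (.appL m2)
  have l2 : ReflTransGen StepCA (app u m2) (app u x) :=
    h2.lift (app u) fun _ _ h' => h'.imp (.appR h.isValue_left) (.appR u)
  exact (l1.trans l2).trans (.head h.stepCA hr)

theorem reflTransGen_stepA_lam {T : MTy} {m w : MTm} (h : ReflTransGen StepA (lam T m) w) :
    (∃ m', w = lam T m' ∧ ReflTransGen StepA m m') ∨
      ∃ m', w = arr T m' ∧ ReflTransGen StepA (subst 0 (ofTy T) m) m' := by
  induction h with
  | refl => exact .inl ⟨m, rfl, .refl⟩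
  | tail _ h ih =>
    rcases ih with ⟨m', rfl, hm⟩ | ⟨m', rfl, hm⟩
    · cases h with
      | lamAbs =>
        exact .inr ⟨_, rfl, reflTransGen_stepA_subst_left (closedUnder_ofTy 0 T) hm 0⟩
      | lamC _ h => exact .inl ⟨_, rfl, hm.tail h⟩
    · cases h with
      | arrC _ h => exact .inr ⟨_, rfl, hm.tail h⟩

theorem reflTransGen_stepA_ca {w : MTm} (h : ReflTransGen StepA ca w) : w = ca ∨ w = tyA := by
  induction h with
  | refl => exact .inl rfl
  | tail _ h ih => rcases ih with rfl | rfl <;> cases h; exact .inr rfl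

theorem reflTransGen_stepA_cf {w : MTm} (h : ReflTransGen StepA cf w) :
    w = cf ∨ w = arr .base tyA := by
  induction h with
  | refl => exact .inl rfl
  | tail _ h ih =>
    rcases ih with rfl | rfl
    · cases h
      exact .inr rfl
    · cases h with
      | arrC _ h => cases h

/-- Reducibility to a given value is invariant under call-by-value reduction. -/
theorem StepC.reflTransGen_stepCA {m m' v : MTm} (h : StepC m m') (hc : ClosedUnder 0 m)
    (hv : IsValue v) (hm : ReflTransGen StepCA m v) : ReflTransGen StepCA m' v := by
  induction h generalizing v with
  | @beta s T m hs =>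
    obtain ⟨u, x, r, h1, h2, h3, h4⟩ := exists_contract hv hm
    have h2 := hs.reflTransGen_stepA h2
    refine (reflTransGen_stepCA_of_stepA ?_).trans h4
    rcases reflTransGen_stepA_lam ((IsValue.lam T m).reflTransGen_stepA h1) with
      ⟨m', rfl, hm'⟩ | ⟨m', rfl, hm'⟩
    · cases h3
      exact (reflTransGen_stepA_subst_left hc.2 hm' 0).trans
        (reflTransGen_stepA_subst_right hc.2 h2 m' 0)
    · cases h3
      exact (reflTransGen_stepA_subst_right hc.2 h2 m 0).trans hm'
  | fa =>
    obtain ⟨u, x, r, h1, h2, h3, h4⟩ := exists_contract hv hm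
    cases h3 with
    | lam T m hs =>
      rcases reflTransGen_stepA_cf (IsValue.cf.reflTransGen_stepA h1) with h | h <;> cases h
    | fa => exact h4
    | arr T m =>
      rcases reflTransGen_stepA_cf (IsValue.cf.reflTransGen_stepA h1) with h | h <;> cases h
      exact .head (.inr .caAbs) h4
  | appL m2 _ ih =>
    obtain ⟨u, x, r, h1, h2, h3, h4⟩ := exists_contract hv hm
    exact reflTransGen_app_of_contract (ih hc.1 h3.isValue_left h1) h2 h3 h4
  | appR _ _ ih =>
    obtain ⟨u, x, r, h1, h2, h3, h4⟩ := exists_contract hv hm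
    exact reflTransGen_app_of_contract h1 (ih hc.2 h3.isValue_right h2) h3 h4

theorem IsStdValue.isValue {t : MTm} (h : IsStdValue t) : IsValue t := by
  cases h <;> constructor

/-- A standard `→c`-normal form that `→ca`-reduces to a value is a standard value. -/
theorem IsStandard.isStdValue {t v : MTm} (ht : IsStandard t) (hv : IsValue v)
    (h : ReflTransGen StepCA t v) (hnf : ∀ u, ¬ StepC t u) : IsStdValue t := by
  induction ht generalizing v with
  | var k =>
    rcases h.cases_head with rfl | ⟨_, h | h, _⟩
    · cases hv
    · cases h
    · cases h
  | lam T ht => exact .lam T ht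
  | ca => exact .ca
  | cf => exact .cf
  | @app t1 t2 _ _ ih1 ih2 =>
    exfalso
    obtain ⟨u, x, r, h1, h2, h3, -⟩ := exists_contract hv h
    have v1 := ih1 h3.isValue_left h1 fun _ h => hnf _ (.appL _ h)
    have v2 := ih2 h3.isValue_right h2 fun _ h => hnf _ (.appR v1.isValue h)
    have h2 := v2.isValue.reflTransGen_stepA h2
    cases v1 with
    | lam T _ => exact hnf _ (.beta T _ v2.isValue)
    | ca =>
      rcases reflTransGen_stepA_ca (IsValue.ca.reflTransGen_stepA h1) with rfl | rfl <;> cases h3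
    | cf =>
      have hx : x = MTm.ca ∨ x = MTm.tyA := by
        rcases reflTransGen_stepA_cf (IsValue.cf.reflTransGen_stepA h1) with rfl | rfl
        · cases h3
          exact .inl rfl
        · cases h3
          exact .inr rfl
      cases v2 with
      | lam T _ =>
        rcases reflTransGen_stepA_lam h2 with ⟨_, rfl, _⟩ | ⟨_, rfl, _⟩ <;> simp at hx
      | ca => exact hnf _ .fa
      | cf => rcases reflTransGen_stepA_cf h2 with rfl | rfl <;> simp at hx

end MTm

open Relation MTm

/-- Generalized Type Safety: the `→c`-normal forms of closed,
generalized-typable standard terms are standard values. -/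
theorem generalized_type_safety (t t' : MTm) (T : MTy)
    (hstd : IsStandard t) (hclosed : ClosedUnder 0 t)
    (htyp : ReflTransGen (fun x y => StepC x y ∨ StepA x y) t (ofTy T))
    (hred : ReflTransGen StepC t t')
    (hnf : ∀ u, ¬ StepC t' u) : IsStdValue t' := by
  have key : IsStandard t' ∧ ClosedUnder 0 t' ∧ ReflTransGen StepCA t' (ofTy T) := by
    clear hnf
    induction hred with
    | refl => exact ⟨hstd, hclosed, htyp⟩
    | tail _ h ih =>
      obtain ⟨h1, h2, h3⟩ := ih
      exact ⟨h.isStandard h2 h1, h.closedUnder h2,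
        h.reflTransGen_stepCA h2 (isValue_ofTy T) h3⟩
  exact key.1.isStdValue (isValue_ofTy T) key.2.2 hnf
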